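/- arXiv:2310.06986 — 3 statements merged into one kernel-verified Lean document; each statement's English description precedes it below -/
import Mathlib

section
/- Let i, k ≥ 2 and j, l ≥ 1 be integers. Then ∫_△ u_{ij}(x,y) b̂_{kl}(x,y) dx dy = 0 whenever (i,j) ≠ (k,l), and ∫_△ u_{ij}(x,y) b̂_{ij}(x,y) dx dy ≠ 0. In other words, the interior H¹ shape functions u_{ij} on the triangle and the functions b̂_{kl} form a biorthogonal system in L²(△). -/
open MeasureTheory

/-- Jacobi polynomial `P_n^{(a,b)}` via the Rodrigues formula (on `(-1,1)`). -/
noncomputable def jacobiP (n a b : ℕ) (x : ℝ) : ℝ :=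
  (1 / ((2:ℝ)^n * (Nat.factorial n : ℝ) * (1 - x)^a * (1 + x)^b)) *
    iteratedDeriv n (fun t : ℝ => (1 - t)^a * (1 + t)^b * (t^2 - 1)^n) x

/-- Legendre polynomial `L_n = P_n^{(0,0)}`. -/
noncomputable def legendreP (n : ℕ) (x : ℝ) : ℝ := jacobiP n 0 0 x

/-- Integrated Jacobi polynomial `P̂_n^a(x) = ∫_{-1}^x P_{n-1}^{(a,0)}(t) dt`. -/
noncomputable def intJacobiP (n a : ℕ) (x : ℝ) : ℝ :=
  ∫ t in (-1:ℝ)..x, jacobiP (n - 1) a 0 t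

/-- Integrated Legendre polynomial `L̂_n`. -/
noncomputable def intLegendreP (n : ℕ) (x : ℝ) : ℝ := intJacobiP n 0 x

/-- The open reference triangle with vertices `(-1,-1)`, `(1,-1)`, `(0,1)`. -/
def Tri : Set (ℝ × ℝ) := {p | -1 < p.2 ∧ p.2 < 1 ∧ |p.1| < (1 - p.2) / 2}

/-- Interior `H¹` shape functions on the triangle. -/
noncomputable def uTri (i j : ℕ) (p : ℝ × ℝ) : ℝ :=
  intLegendreP i (2 * p.1 / (1 - p.2)) * ((1 - p.2) / 2)^i * intJacobiP j (2*i) p.2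

/-- Dual functions on the triangle. -/
noncomputable def bTri (k l : ℕ) (p : ℝ × ℝ) : ℝ :=
  jacobiP (k-2) 1 1 (2 * p.1 / (1 - p.2)) * ((1 - p.2) / 2)^(k-2) *
    jacobiP (l-1) (2*k-1) 1 p.2


open Polynomial

noncomputable def pI (p : ℝ[X]) : ℝ := ∫ t in (-1:ℝ)..1, p.eval t

lemma pI_add (p q : ℝ[X]) : pI (p + q) = pI p + pI q := by
  unfold pI
  simp only [eval_add]
  exact intervalIntegral.integral_add (p.continuous.intervalIntegrable _ _)
    (q.continuous.intervalIntegrable _ _)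

lemma pI_C_mul (c : ℝ) (p : ℝ[X]) : pI (C c * p) = c * pI p := by
  unfold pI
  simp only [eval_mul, eval_C]
  exact intervalIntegral.integral_const_mul _ _

lemma pI_zero : pI 0 = 0 := by simp [pI]

lemma pI_sum {ι : Type*} (s : Finset ι) (f : ι → ℝ[X]) :
    pI (∑ i ∈ s, f i) = ∑ i ∈ s, pI (f i) := by
  classical
  induction s using Finset.induction_on with
  | empty => simp [pI_zero]
  | insert a s ha ih => rw [Finset.sum_insert ha, Finset.sum_insert ha, pI_add, ih]

lemma integral_derivative (p : ℝ[X]) (a b : ℝ) :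
    ∫ t in a..b, (derivative p).eval t = p.eval b - p.eval a :=
  intervalIntegral.integral_eq_sub_of_hasDerivAt (fun x _ => p.hasDerivAt x)
    ((derivative p).continuous.intervalIntegrable _ _)

lemma pI_derivative (p : ℝ[X]) : pI (derivative p) = p.eval 1 - p.eval (-1) :=
  integral_derivative p _ _

noncomputable def pw (a b : ℕ) : ℝ[X] := (1 - X) ^ a * (1 + X) ^ b

noncomputable def pW (n a b : ℕ) : ℝ[X] := pw a b * (X ^ 2 - 1) ^ n

lemma pW_eq (n a b : ℕ) : pW n a b = C ((-1) ^ n) * ((1 - X) ^ (a + n) * (1 + X) ^ (b + n)) := by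
  have : (X ^ 2 - 1 : ℝ[X]) = C (-1) * ((1 - X) * (1 + X)) := by
    simp only [map_neg, map_one]; ring
  rw [pW, pw, this, mul_pow, mul_pow, map_pow]; ring

lemma dvd1 (n a b m : ℕ) : (1 - X : ℝ[X]) ^ (a + n - m) ∣ derivative^[m] (pW n a b) :=
  pow_sub_dvd_iterate_derivative_of_pow_dvd m
    (by rw [pW_eq]; exact (dvd_mul_right _ _).mul_left _)

lemma dvd2 (n a b m : ℕ) : (1 + X : ℝ[X]) ^ (b + n - m) ∣ derivative^[m] (pW n a b) :=
  pow_sub_dvd_iterate_derivative_of_pow_dvd m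
    (by rw [pW_eq]; exact (dvd_mul_left _ _).mul_left _)

lemma eval_one_iter (n a b m : ℕ) (h : m < n) : (derivative^[m] (pW n a b)).eval 1 = 0 := by
  obtain ⟨r, hr⟩ := dvd1 n a b m
  rw [hr, eval_mul, eval_pow]
  have : a + n - m ≠ 0 := by omega
  simp [this]

lemma eval_neg_one_iter (n a b m : ℕ) (h : m < b + n) :
    (derivative^[m] (pW n a b)).eval (-1) = 0 := by
  obtain ⟨r, hr⟩ := dvd2 n a b m
  rw [hr, eval_mul, eval_pow]
  have : b + n - m ≠ 0 := by omega
  simp [this]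

lemma pI_parts (n a b : ℕ) (m : ℕ) (hm : m ≤ n) (q : ℝ[X]) :
    pI (derivative^[m] (pW n a b) * q) = (-1) ^ m * pI (pW n a b * derivative^[m] q) := by
  induction m generalizing q with
  | zero => simp
  | succ m ih =>
    have h1 := pI_derivative (derivative^[m] (pW n a b) * q)
    rw [eval_mul, eval_mul, eval_one_iter n a b m (by omega),
      eval_neg_one_iter n a b m (by omega), derivative_mul, pI_add, ih (by omega)] at h1
    rw [Function.iterate_succ_apply', Function.iterate_succ_apply, pow_succ]
    linarith

lemma pI_pW_ne (n a b : ℕ) : pI (pW n a b) ≠ 0 := by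
  rw [pW_eq, pI_C_mul]
  refine mul_ne_zero (pow_ne_zero _ (by norm_num)) (ne_of_gt ?_)
  unfold pI
  refine intervalIntegral.intervalIntegral_pos_of_pos_on
    ((Polynomial.continuous _).intervalIntegrable _ _) ?_ (by norm_num)
  intro x hx
  have h1 : 0 < 1 - x := by linarith [hx.2]
  have h2 : 0 < 1 + x := by linarith [hx.1]
  simp only [eval_mul, eval_pow, eval_sub, eval_add, eval_one, eval_X]
  positivity

lemma pI_orth (n a b : ℕ) (q : ℝ[X]) (hq : q.natDegree < n) :
    pI (derivative^[n] (pW n a b) * q) = 0 := by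
  rw [pI_parts n a b n le_rfl, iterate_derivative_eq_zero hq]
  simp [pI_zero]

lemma pI_ne (n a b : ℕ) (q : ℝ[X]) (hq : q.natDegree = n) (h0 : q ≠ 0) :
    pI (derivative^[n] (pW n a b) * q) ≠ 0 := by
  have h1 : derivative^[n] q = C (n.factorial * q.leadingCoeff) := by
    rw [eq_C_of_natDegree_eq_zero (p := derivative^[n] q)
      (by have := natDegree_iterate_derivative q n; omega), coeff_iterate_derivative]
    simp [leadingCoeff, hq, Nat.descFactorial_self]
  rw [pI_parts n a b n le_rfl, h1, mul_comm (pW n a b), pI_C_mul]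
  refine mul_ne_zero (pow_ne_zero _ (by norm_num)) (mul_ne_zero (mul_ne_zero ?_ ?_) (pI_pW_ne _ _ _))
  · exact_mod_cast n.factorial_ne_zero
  · exact leadingCoeff_ne_zero.2 h0

lemma natDegree_iter (p : ℝ[X]) (n : ℕ) : (derivative^[n] p).natDegree = p.natDegree - n := by
  induction n with
  | zero => simp
  | succ n ih => rw [Function.iterate_succ_apply', natDegree_derivative, ih]; omega

lemma nd1 : (1 - X : ℝ[X]).natDegree = 1 := by
  rw [show (1 - X : ℝ[X]) = -(X - C 1) by simp, natDegree_neg, natDegree_X_sub_C]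
lemma nd2 : (1 + X : ℝ[X]).natDegree = 1 := by
  rw [show (1 + X : ℝ[X]) = (X + C 1) by simp [add_comm], natDegree_X_add_C]
lemma ne1 : (1 - X : ℝ[X]) ≠ 0 := by
  intro h; have := nd1; rw [h] at this; simp at this
lemma ne2 : (1 + X : ℝ[X]) ≠ 0 := by
  intro h; have := nd2; rw [h] at this; simp at this
lemma pw_ne (a b : ℕ) : pw a b ≠ 0 := mul_ne_zero (pow_ne_zero _ ne1) (pow_ne_zero _ ne2)
lemma natDegree_pw (a b : ℕ) : (pw a b).natDegree = a + b := by
  rw [pw, natDegree_mul (pow_ne_zero _ ne1) (pow_ne_zero _ ne2), natDegree_pow, natDegree_pow,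
    nd1, nd2]; ring
lemma natDegree_pW (n a b : ℕ) : (pW n a b).natDegree = a + b + 2 * n := by
  rw [pW_eq, natDegree_C_mul (pow_ne_zero _ (by norm_num))]
  have := natDegree_pw (a + n) (b + n)
  rw [pw] at this
  rw [this]; ring

lemma exists_J (n a b : ℕ) : ∃ J : ℝ[X], derivative^[n] (pW n a b) = pw a b * J ∧
    J ≠ 0 ∧ J.natDegree = n := by
  have hc : IsCoprime ((1 - X : ℝ[X]) ^ a) ((1 + X) ^ b) := by
    apply IsCoprime.pow
    refine ⟨C (1/2), C (1/2), ?_⟩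
    have : (C (1/2) : ℝ[X]) * 2 = 1 := by
      rw [show (2 : ℝ[X]) = C 2 from rfl, ← C_mul]; norm_num
    linear_combination this
  have h1 := dvd1 n a b n
  have h2 := dvd2 n a b n
  rw [Nat.add_sub_cancel] at h1 h2
  obtain ⟨J, hJ⟩ := hc.mul_dvd h1 h2
  have hne : J ≠ 0 := by
    rintro rfl
    have := pI_ne n a b (X ^ n) (by simp) (by simp)
    rw [hJ] at this
    simp [pI_zero] at this
  refine ⟨J, hJ, hne, ?_⟩
  have h3 := congrArg natDegree hJ
  have h4 := natDegree_mul (pw_ne a b) hne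
  rw [natDegree_pw, pw] at h4
  rw [natDegree_iter, natDegree_pW, h4] at h3
  omega

noncomputable def pJ (n a b : ℕ) : ℝ[X] := (exists_J n a b).choose
lemma pJ_eq (n a b : ℕ) : derivative^[n] (pW n a b) = pw a b * pJ n a b :=
  (exists_J n a b).choose_spec.1
lemma pJ_ne (n a b : ℕ) : pJ n a b ≠ 0 := (exists_J n a b).choose_spec.2.1
lemma pJ_deg (n a b : ℕ) : (pJ n a b).natDegree = n := (exists_J n a b).choose_spec.2.2

lemma iteratedDeriv_poly (p : ℝ[X]) (n : ℕ) :
    iteratedDeriv n (fun t => p.eval t) = fun t => (derivative^[n] p).eval t := by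
  induction n with
  | zero => simp
  | succ n ih =>
    rw [iteratedDeriv_succ, ih, Function.iterate_succ_apply']
    ext x
    exact Polynomial.deriv _

noncomputable def cJ (n : ℕ) : ℝ := 1 / (2 ^ n * n.factorial)

lemma cJ_ne (n : ℕ) : cJ n ≠ 0 := by
  unfold cJ; have := n.factorial_ne_zero; positivity

lemma jacobiP_eq (n a b : ℕ) (x : ℝ) (hx : x ∈ Set.Ioo (-1:ℝ) 1) :
    jacobiP n a b x = cJ n * (pJ n a b).eval x := by
  have h : (fun t : ℝ => (1 - t)^a * (1 + t)^b * (t^2 - 1)^n) = fun t => (pW n a b).eval t := by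
    ext t; simp [pW, pw]
  have h1 : 0 < 1 - x := by linarith [hx.2]
  have h2 : 0 < 1 + x := by linarith [hx.1]
  rw [jacobiP, h, iteratedDeriv_poly]
  simp only [pJ_eq, eval_mul, pw, eval_pow, eval_sub, eval_add, eval_one, eval_X, cJ]
  have := n.factorial_ne_zero
  field_simp

lemma exists_anti (p : ℝ[X]) : ∃ F : ℝ[X], derivative F = p := by
  induction p using Polynomial.induction_on' with
  | add p q hp hq =>
    obtain ⟨F, rfl⟩ := hp
    obtain ⟨G, rfl⟩ := hq
    exact ⟨F + G, derivative_add⟩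
  | monomial n a =>
    refine ⟨monomial (n + 1) (a / (n + 1)), ?_⟩
    rw [derivative_monomial]
    have : (n : ℝ) + 1 ≠ 0 := by positivity
    simp [this]

lemma intJacobiP_eq (n a : ℕ) (F : ℝ[X]) (c : ℝ)
    (hF : derivative F = C c * pJ (n - 1) a 0) (x : ℝ) (hx : x ∈ Set.Ioo (-1:ℝ) 1) :
    c * intJacobiP n a x = cJ (n - 1) * (F.eval x - F.eval (-1)) := by
  rw [← integral_derivative, intJacobiP, ← intervalIntegral.integral_const_mul,
    ← intervalIntegral.integral_const_mul]
  apply intervalIntegral.integral_congr_ae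
  filter_upwards with t ht
  rw [Set.uIoc_of_le hx.1.le] at ht
  rw [jacobiP_eq _ _ _ _ ⟨ht.1, lt_of_le_of_lt ht.2 hx.2⟩, hF, eval_mul, eval_C]; ring

lemma intLegendre_eq (m : ℕ) (x : ℝ) (hx : x ∈ Set.Ioo (-1:ℝ) 1) :
    intLegendreP (m + 2) x = - cJ (m + 1) * (pw 1 1 * pJ m 1 1).eval x := by
  have h0 : pW m 1 1 = - pW (m + 1) 0 0 := by
    simp only [pW, pw]; ring
  have h1 : derivative (derivative^[m] (pW m 1 1)) = C (-1) * pJ (m + 2 - 1) 0 0 := by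
    have := pJ_eq (m + 1) 0 0
    rw [h0, iterate_derivative_neg, derivative_neg, ← Function.iterate_succ_apply' derivative, this]
    simp [pw]
  have h2 := intJacobiP_eq (m + 2) 0 _ _ h1 x hx
  rw [eval_neg_one_iter m 1 1 m (by omega), pJ_eq] at h2
  rw [intLegendreP]
  rw [show m + 2 - 1 = m + 1 from rfl] at h2
  linarith

lemma anti_props (n a : ℕ) : ∃ Q : ℝ[X], Q ≠ 0 ∧ Q.natDegree = n ∧
    derivative ((1 + X) * Q) = pJ n a 0 := by
  obtain ⟨F, hF⟩ := exists_anti (pJ n a 0)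
  have h1 : derivative (F - C (F.eval (-1))) = pJ n a 0 := by simp [hF]
  have h2 : (X - C (-1)) ∣ (F - C (F.eval (-1))) := by
    rw [dvd_iff_isRoot]; simp
  obtain ⟨Q, hQ⟩ := h2
  have h3 : (X - C (-1) : ℝ[X]) = 1 + X := by simp; ring
  rw [h3] at hQ
  rw [hQ] at h1
  have hne : Q ≠ 0 := by
    rintro rfl
    exact pJ_ne n a 0 (by rw [← h1]; simp)
  refine ⟨Q, hne, ?_, h1⟩
  have h4 := congrArg natDegree h1
  rw [natDegree_derivative, natDegree_mul ne2 hne, nd2, pJ_deg] at h4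
  omega

lemma intJacobi_form (n a : ℕ) (Q : ℝ[X]) (hQ : derivative ((1 + X) * Q) = pJ n a 0)
    (x : ℝ) (hx : x ∈ Set.Ioo (-1:ℝ) 1) :
    intJacobiP (n + 1) a x = cJ n * ((1 + X) * Q).eval x := by
  have h := intJacobiP_eq (n + 1) a ((1 + X) * Q) 1 (by rw [hQ]; simp) x hx
  simpa using h

lemma orth_F (n a : ℕ) (F : ℝ[X]) (hF : derivative F = pJ n (a + 1) 0) (hF0 : F.eval (-1) = 0)
    (q : ℝ[X]) (hq : q.natDegree < n) : pI ((1 - X) ^ a * F * q) = 0 := by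
  have key : ∀ m < n, pI ((1 - X) ^ a * F * (1 - X) ^ m) = 0 := by
    intro m hm
    have h1 := pI_derivative (F * (1 - X) ^ (a + m + 1))
    have h2 := pI_orth n (a + 1) 0 ((1 - X) ^ m) (by rw [natDegree_pow, nd1]; omega)
    rw [pJ_eq] at h2
    have h3 : derivative (F * (1 - X) ^ (a + m + 1)) = pw (a + 1) 0 * pJ n (a + 1) 0 * (1 - X) ^ m
        + C (-((a:ℝ) + m + 1)) * ((1 - X) ^ a * F * (1 - X) ^ m) := by
      rw [derivative_mul, hF, derivative_pow]
      simp [pw]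
      ring
    rw [h3, pI_add, h2, pI_C_mul] at h1
    have h4 : (a:ℝ) + m + 1 ≠ 0 := by positivity
    simp [hF0] at h1
    rcases h1 with h1 | h1
    · exact absurd (by linarith) h4
    · exact h1
  have hr : q = ∑ m ∈ Finset.range n, C ((q.comp (1 - X)).coeff m) * (1 - X) ^ m := by
    have h1 : (q.comp (1 - X)).comp (1 - X) = q := by
      rw [comp_assoc]; simp
    have h2 : (q.comp (1 - X)).natDegree < n := by rw [natDegree_comp, nd1]; omega
    conv_lhs => rw [← h1, (q.comp (1 - X)).as_sum_range' n h2]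
    rw [Polynomial.sum_comp]
    simp
  rw [hr, Finset.mul_sum, pI_sum]
  refine Finset.sum_eq_zero fun m hm => ?_
  rw [mul_left_comm, pI_C_mul, key m (Finset.mem_range.1 hm), mul_zero]

noncomputable def phiT (p : ℝ × ℝ) : ℝ × ℝ := (p.1 * ((1 - p.2) / 2), p.2)

noncomputable def phiT' (p : ℝ × ℝ) : ℝ × ℝ →L[ℝ] ℝ × ℝ :=
  (Matrix.toLin (.finTwoProd ℝ) (.finTwoProd ℝ)
    !![(1 - p.2) / 2, -(p.1 / 2); 0, 1]).toContinuousLinearMap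

lemma hasFDerivAt_phiT (p : ℝ × ℝ) : HasFDerivAt phiT (phiT' p) p := by
  unfold phiT'
  rw [Matrix.toLin_finTwoProd_toContinuousLinearMap]
  have h1 : HasFDerivAt (fun p : ℝ × ℝ => p.1) (ContinuousLinearMap.fst ℝ ℝ ℝ) p := hasFDerivAt_fst
  have h2 : HasFDerivAt (fun p : ℝ × ℝ => p.2) (ContinuousLinearMap.snd ℝ ℝ ℝ) p := hasFDerivAt_snd
  have h3 := (h2.const_sub 1).mul_const (2⁻¹ : ℝ)
  have h4 := HasFDerivAt.prodMk (h1.mul h3) h2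
  convert! h4 using 1
  ext <;> simp <;> ring

lemma det_phiT' (p : ℝ × ℝ) : (phiT' p).det = (1 - p.2) / 2 := by
  unfold phiT'
  simp only [LinearMap.det_toContinuousLinearMap, LinearMap.det_toLin, Matrix.det_fin_two_of]
  ring

lemma image_phiT : phiT '' (Set.Ioo (-1:ℝ) 1 ×ˢ Set.Ioo (-1:ℝ) 1) = Tri := by
  ext ⟨x, y⟩
  simp only [Set.mem_image, Prod.exists, Set.mem_prod, Set.mem_Ioo, phiT, Tri, Prod.mk.injEq]
  constructor
  · rintro ⟨t, s, ⟨⟨h1, h2⟩, h3, h4⟩, rfl, rfl⟩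
    refine ⟨h3, h4, ?_⟩
    have h5 : 0 < (1 - s) / 2 := by linarith
    show |t * ((1 - s) / 2)| < (1 - s) / 2
    rw [abs_mul, abs_of_pos h5]
    have : |t| < 1 := abs_lt.2 ⟨h1, h2⟩
    nlinarith
  · rintro ⟨h1, h2, h3⟩
    dsimp only at h1 h2 h3
    have h5 : 0 < (1 - y) / 2 := by linarith
    refine ⟨x / ((1 - y) / 2), y, ⟨abs_lt.1 ?_, h1, h2⟩, ?_, rfl⟩
    · rw [abs_div, abs_of_pos h5, div_lt_one h5]; exact h3
    · exact div_mul_cancel₀ _ h5.ne'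

lemma integral_Tri (f : ℝ × ℝ → ℝ) (g h : ℝ → ℝ)
    (hf : ∀ t ∈ Set.Ioo (-1:ℝ) 1, ∀ y ∈ Set.Ioo (-1:ℝ) 1,
      (1 - y) / 2 * f (phiT (t, y)) = g t * h y) :
    ∫ p in Tri, f p = (∫ t in (-1:ℝ)..1, g t) * ∫ y in (-1:ℝ)..1, h y := by
  have hm : MeasurableSet (Set.Ioo (-1:ℝ) 1 ×ˢ Set.Ioo (-1:ℝ) 1) :=
    measurableSet_Ioo.prod measurableSet_Ioo
  rw [← image_phiT, integral_image_eq_integral_abs_det_fderiv_smul volume hm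
    (fun x _ => (hasFDerivAt_phiT x).hasFDerivWithinAt)]
  · rw [intervalIntegral.integral_of_le (by norm_num), intervalIntegral.integral_of_le (by norm_num),
      integral_Ioc_eq_integral_Ioo, integral_Ioc_eq_integral_Ioo, ← setIntegral_prod_mul]
    apply setIntegral_congr_fun hm
    rintro ⟨t, y⟩ ⟨ht, hy⟩
    have h5 : 0 < (1 - y) / 2 := by linarith [hy.2]
    simp only [det_phiT', abs_of_pos h5, smul_eq_mul]
    exact hf t ht y hy
  · rintro ⟨t, y⟩ ⟨ht, hy⟩ ⟨s, z⟩ ⟨hs, hz⟩ h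
    simp only [phiT, Prod.mk.injEq] at h
    obtain ⟨h1, rfl⟩ := h
    have h5 : (1 - y) / 2 ≠ 0 := by have : y < 1 := hy.2; intro h; linarith
    rw [mul_right_cancel₀ h5 h1]

lemma main_factor (m J r L : ℕ) (Q : ℝ[X])
    (hQ : derivative ((1 + X) * Q) = pJ J (2 * (m + 2)) 0) :
    ∃ K : ℝ, K ≠ 0 ∧ ∫ p in Tri, uTri (m + 2) (J + 1) p * bTri (r + 2) (L + 1) p =
      pI (pw 1 1 * pJ m 1 1 * pJ r 1 1) *
        (K * pI ((1 - X) ^ (m + r + 3) * ((1 + X) * Q) * pJ L (2 * r + 3) 1)) := by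
  refine ⟨-cJ (m + 1) * cJ J * cJ r * cJ L / 2 ^ (m + r + 3), ?_, ?_⟩
  · exact div_ne_zero (mul_ne_zero (mul_ne_zero (mul_ne_zero (neg_ne_zero.2 (cJ_ne _)) (cJ_ne _))
      (cJ_ne _)) (cJ_ne _)) (by positivity)
  · rw [pI, pI, ← intervalIntegral.integral_const_mul]
    apply integral_Tri
    intro t ht y hy
    have h5 : (1 - y) ≠ 0 := by have : y < 1 := hy.2; intro h; linarith
    have h6 : 2 * (t * ((1 - y) / 2)) / (1 - y) = t := by field_simp
    have h7 : 2 * (r + 2) - 1 = 2 * r + 3 := by omega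
    simp only [phiT, uTri, bTri, h6, h7, Nat.add_sub_cancel]
    rw [intLegendre_eq m t ht, intJacobi_form J _ Q hQ y hy, jacobiP_eq _ _ _ _ ht,
      jacobiP_eq _ _ _ _ hy]
    simp only [eval_mul, eval_pow, eval_sub, eval_one, eval_X, div_pow]
    field_simp
    ring

/-- Biorthogonality of the interior `H¹` shape functions and the dual functions
on the triangle. -/
theorem triangle_H1_biorthogonal (i j k l : ℕ) (hi : 2 ≤ i) (hk : 2 ≤ k)
    (hj : 1 ≤ j) (hl : 1 ≤ l) :
    ((i, j) ≠ (k, l) → ∫ p in Tri, uTri i j p * bTri k l p = 0) ∧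
    (∫ p in Tri, uTri i j p * bTri i j p) ≠ 0 := by
  obtain ⟨m, rfl⟩ := Nat.exists_eq_add_of_le' hi
  obtain ⟨r, rfl⟩ := Nat.exists_eq_add_of_le' hk
  obtain ⟨J, rfl⟩ := Nat.exists_eq_add_of_le' hj
  obtain ⟨L, rfl⟩ := Nat.exists_eq_add_of_le' hl
  obtain ⟨Q, hQ0, hQd, hQ⟩ := anti_props J (2 * (m + 2))
  constructor
  · intro hne
    obtain ⟨K, -, hK⟩ := main_factor m J r L Q hQ
    rw [hK]
    rcases lt_trichotomy m r with h | rfl | h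
    · have := pI_orth r 1 1 (pJ m 1 1) (by rw [pJ_deg]; exact h)
      rw [pJ_eq] at this
      rw [mul_right_comm, this, zero_mul]
    · have e : m + m + 3 = 2 * m + 3 := by ring
      rw [e]
      have hJL : J ≠ L := by rintro rfl; exact hne rfl
      rcases lt_or_gt_of_ne hJL with h | h
      · have := pI_orth L (2 * m + 3) 1 Q (by rw [hQd]; exact h)
        rw [pJ_eq] at this
        have e2 : (1 - X) ^ (2 * m + 3) * ((1 + X) * Q) * pJ L (2 * m + 3) 1
            = pw (2 * m + 3) 1 * pJ L (2 * m + 3) 1 * Q := by rw [pw]; ring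
        rw [e2, this, mul_zero, mul_zero]
      · rw [orth_F J (2 * m + 3) ((1 + X) * Q) hQ (by simp) _ (by rw [pJ_deg]; exact h),
          mul_zero, mul_zero]
    · have := pI_orth m 1 1 (pJ r 1 1) (by rw [pJ_deg]; exact h)
      rw [pJ_eq] at this
      rw [this, zero_mul]
  · obtain ⟨K, hK0, hK⟩ := main_factor m J m J Q hQ
    rw [hK]
    have h1 := pI_ne m 1 1 (pJ m 1 1) (pJ_deg _ _ _) (pJ_ne _ _ _)
    have h2 := pI_ne J (2 * m + 3) 1 Q hQd hQ0
    rw [pJ_eq] at h1 h2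
    have e : m + m + 3 = 2 * m + 3 := by ring
    have e2 : (1 - X) ^ (m + m + 3) * ((1 + X) * Q) * pJ J (2 * m + 3) 1
        = pw (2 * m + 3) 1 * pJ J (2 * m + 3) 1 * Q := by rw [pw, e]; ring
    rw [e2]
    exact mul_ne_zero h1 (mul_ne_zero hK0 h2)
end

section
/- Let i ≥ 2 and j ≥ 1 be integers. Then ∫_△ u_{ij}(x,y) b̂_{ij}(x,y) dx dy = −16/( i (2i−1) (2j+2i−1) (j+2i−1) ). -/
open MeasureTheory

namespace TriAux

open Polynomial

noncomputable def W (n a b : ℕ) : ℝ[X] := (1 - X)^a * (1 + X)^b * (X^2 - 1)^n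

lemma iter_eval (p : ℝ[X]) (n : ℕ) :
    iteratedDeriv n (fun x : ℝ => p.eval x) = fun x => (derivative^[n] p).eval x := by
  induction n generalizing p with
  | zero => simp
  | succ n ih =>
    rw [iteratedDeriv_succ', Function.iterate_succ_apply]
    have : deriv (fun x : ℝ => p.eval x) = fun x => (derivative p).eval x := by
      ext x; simp
    rw [this, ih]

lemma jac (n a b : ℕ) (x : ℝ) : jacobiP n a b x =
    (1 / ((2:ℝ)^n * (Nat.factorial n : ℝ) * (1 - x)^a * (1 + x)^b)) *
      (derivative^[n] (W n a b)).eval x := by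
  unfold jacobiP
  have : (fun t : ℝ => (1 - t)^a * (1 + t)^b * (t^2 - 1)^n) = fun t => (W n a b).eval t := by
    ext t; simp [W]
  rw [this, iter_eval]

lemma pint (p : ℝ[X]) (s t : ℝ) : IntervalIntegrable (fun x => p.eval x) volume s t :=
  p.continuous.intervalIntegrable _ _

lemma ftc (p : ℝ[X]) (s t : ℝ) :
    ∫ x in s..t, (derivative p).eval x = p.eval t - p.eval s :=
  intervalIntegral.integral_eq_sub_of_hasDerivAt (fun x _ => p.hasDerivAt x) (pint _ _ _)

lemma parts (p q : ℝ[X]) (h1 : (p * q).eval 1 = 0) (h2 : (p * q).eval (-1) = 0) :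
    ∫ x in (-1:ℝ)..1, (p * derivative q).eval x =
      - ∫ x in (-1:ℝ)..1, (derivative p * q).eval x := by
  have := ftc (p * q) (-1) 1
  rw [h1, h2, derivative_mul] at this
  simp only [eval_add] at this
  rw [intervalIntegral.integral_add (pint _ _ _) (pint _ _ _)] at this
  linarith

lemma parts_iter (n : ℕ) (w p : ℝ[X])
    (h : ∀ k < n, (derivative^[k] w).eval 1 = 0 ∧ (derivative^[k] w).eval (-1) = 0) :
    ∫ x in (-1:ℝ)..1, (p * derivative^[n] w).eval x =
      (-1)^n * ∫ x in (-1:ℝ)..1, (derivative^[n] p * w).eval x := by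
  induction n generalizing p with
  | zero => simp
  | succ n ih =>
    rw [Function.iterate_succ_apply' derivative n w, parts, ih (derivative p)
      (fun k hk => h k (by omega)), ← Function.iterate_succ_apply derivative n p, pow_succ]
    · ring
    · simp [(h n (by omega)).1]
    · simp [(h n (by omega)).2]

lemma vanish (n k : ℕ) (hk : k < n) (w : ℝ[X]) (h : (X^2 - 1)^n ∣ w) :
    (derivative^[k] w).eval 1 = 0 ∧ (derivative^[k] w).eval (-1) = 0 := by
  have h1 := pow_sub_dvd_iterate_derivative_of_pow_dvd k h
  have h2 := (dvd_pow_self (X^2 - 1 : ℝ[X]) (by omega : n - k ≠ 0)).trans h1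
  obtain ⟨r, hr⟩ := h2
  rw [hr]; simp

lemma beta (q : ℕ) : ∀ p : ℕ, ∫ x in (-1:ℝ)..1, ((1 - X)^p * (1 + X)^q : ℝ[X]).eval x =
    2^(p+q+1) * p.factorial * q.factorial / (p+q+1).factorial := by
  induction q with
  | zero =>
    intro p
    have hp : (p:ℝ) + 1 ≠ 0 := by positivity
    have := ftc (C (-1/((p:ℝ)+1)) * (1 - X)^(p+1)) (-1) 1
    have h2 : derivative (C (-1/((p:ℝ)+1)) * (1 - X)^(p+1)) = ((1 - X)^p * (1 + X)^0 : ℝ[X]) := by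
      rw [derivative_C_mul, derivative_pow_succ]
      simp only [derivative_sub, derivative_one, derivative_X]
      have : (C (-1/((p:ℝ)+1)) : ℝ[X]) * C ((p:ℝ)+1) = -1 := by
        rw [← C_mul, div_mul_cancel₀ _ hp]; simp
      linear_combination (-(1-X)^p) * this
    rw [h2] at this
    rw [this]
    have hf : (p.factorial : ℝ) ≠ 0 := by positivity
    simp [Nat.factorial_succ]
    field_simp
    norm_num
  | succ q ih =>
    intro p
    have hp : (p:ℝ) + 1 ≠ 0 := by positivity
    have h2 : derivative (C (-1/((p:ℝ)+1)) * (1 - X)^(p+1)) = ((1 - X)^p : ℝ[X]) := by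
      rw [derivative_C_mul, derivative_pow_succ]
      simp only [derivative_sub, derivative_one, derivative_X]
      have : (C (-1/((p:ℝ)+1)) : ℝ[X]) * C ((p:ℝ)+1) = -1 := by
        rw [← C_mul, div_mul_cancel₀ _ hp]; simp
      linear_combination (-(1-X)^p) * this
    have h3 := parts ((1+X)^(q+1)) (C (-1/((p:ℝ)+1)) * (1 - X)^(p+1)) (by simp) (by simp)
    rw [h2] at h3
    rw [mul_comm ((1 - X : ℝ[X])^p), h3]
    have h4 : derivative ((1+X : ℝ[X])^(q+1)) * (C (-1/((p:ℝ)+1)) * (1 - X)^(p+1)) =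
       C (-((q:ℝ)+1)/((p:ℝ)+1)) * ((1-X)^(p+1) * (1+X)^q) := by
      rw [derivative_pow_succ]
      simp only [derivative_add, derivative_one, derivative_X]
      have : (C (-((q:ℝ)+1)/((p:ℝ)+1)) : ℝ[X]) = C (-1/((p:ℝ)+1)) * C ((q:ℝ)+1) := by
        rw [← C_mul]; congr 1; ring
      rw [this]; ring
    rw [h4]
    simp only [eval_C_mul]
    rw [intervalIntegral.integral_const_mul, ih, show p + 1 + q + 1 = p + (q+1) + 1 by ring,
      Nat.factorial_succ p, Nat.factorial_succ q]
    push_cast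
    field_simp

lemma key (n a b : ℕ) (Q : ℝ[X]) (hQ : Q.natDegree ≤ n) :
    ∫ x in (-1:ℝ)..1, (Q * derivative^[n] (W n a b)).eval x =
      n.factorial * Q.coeff n * (2^(a+n+(b+n)+1) * (a+n).factorial * (b+n).factorial /
        (a+n+(b+n)+1).factorial) := by
  rw [parts_iter n _ _ (fun k hk => vanish n k hk (W n a b) (Dvd.intro_left _ rfl))]
  have h1 : derivative^[n] Q = C (n.factorial * Q.coeff n) := by
    ext m
    rw [coeff_iterate_derivative, coeff_C]
    split_ifs with h
    · subst h; simp [Nat.descFactorial_self]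
    · rw [coeff_eq_zero_of_natDegree_lt (by omega)]; simp
  have h2 : W n a b = C ((-1)^n) * ((1 - X)^(a+n) * (1+X)^(b+n)) := by
    have : (X^2 - 1 : ℝ[X]) = -1 * ((1-X)*(1+X)) := by ring
    rw [W, this, mul_pow, mul_pow, pow_add, pow_add, C_pow, C_neg, C_1]
    ring
  rw [h1, h2]
  simp only [eval_C_mul]
  rw [intervalIntegral.integral_const_mul, intervalIntegral.integral_const_mul, beta]
  have : ((-1:ℝ)^n)*(-1)^n = 1 := by rw [← mul_pow]; simp
  linear_combination (n.factorial * Q.coeff n * (2^(a+n+(b+n)+1) * (a+n).factorial * (b+n).factorial /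
        (a+n+(b+n)+1).factorial)) * this

lemma natDegree_lin (a : ℕ) : ((1 - X : ℝ[X])^a).natDegree = a := by
  have : (1 - X : ℝ[X]) = -(X - C 1) := by simp
  rw [natDegree_pow, this, natDegree_neg, natDegree_X_sub_C, mul_one]

lemma coeff_lin (a : ℕ) : ((1 - X : ℝ[X])^a).coeff a = (-1)^a := by
  have : (1 - X : ℝ[X]) = -(X - C 1) := by simp
  have h := coeff_natDegree (p := (1 - X : ℝ[X])^a)
  rw [natDegree_lin] at h
  rw [h, leadingCoeff_pow, this, leadingCoeff_neg, leadingCoeff_X_sub_C]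

lemma natDegree_quad (n : ℕ) : ((X^2 - 1 : ℝ[X])^n).natDegree = 2*n := by
  have : (X^2 - 1 : ℝ[X]) = X^2 - C 1 := by simp
  rw [natDegree_pow, this, natDegree_X_pow_sub_C, mul_comm]

lemma coeff_quad (n : ℕ) : ((X^2 - 1 : ℝ[X])^n).coeff (2*n) = 1 := by
  have : (X^2 - 1 : ℝ[X]) = X^2 - C 1 := by simp
  conv_lhs => rw [← natDegree_quad n]
  rw [coeff_natDegree, leadingCoeff_pow, this, leadingCoeff_X_pow_sub_C (by norm_num)]
  simp

/-- polynomial part of the b=0 Jacobi polynomial -/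
lemma jacpoly (n a : ℕ) : ∃ P : ℝ[X], derivative^[n] (W n a 0) = (1 - X)^a * P ∧
    P.natDegree ≤ n ∧ P.coeff n = ((a+2*n).factorial / (a+n).factorial : ℝ) := by
  have hW : W n a 0 = (1-X)^a * (X^2-1)^n := by simp [W]
  have hd : (1 - X : ℝ[X])^(a+n) ∣ W n a 0 := by
    have : (X^2 - 1 : ℝ[X]) = (1-X) * (-(1+X)) := by ring
    rw [hW, this, mul_pow, ← mul_assoc, ← pow_add]
    exact Dvd.intro _ rfl
  have h := pow_sub_dvd_iterate_derivative_of_pow_dvd n hd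
  rw [Nat.add_sub_cancel] at h
  obtain ⟨P, hP⟩ := h
  have hne : ((1 - X : ℝ[X])^a) ≠ 0 := by
    intro h0; have := coeff_lin a; rw [h0] at this; simp at this
    exact absurd this.symm (by simp)
  have hWd : (W n a 0).natDegree ≤ a + 2*n := by
    rw [hW]; refine natDegree_mul_le.trans ?_
    rw [natDegree_lin, natDegree_quad]
  have hPd : P.natDegree ≤ n := by
    by_cases hP0 : P = 0
    · simp [hP0]
    have h1 := natDegree_iterate_derivative (W n a 0) n
    rw [hP, natDegree_mul hne hP0, natDegree_lin] at h1
    omega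
  refine ⟨P, hP, hPd, ?_⟩
  have h1 : (derivative^[n] (W n a 0)).coeff (a+n) = (-1)^a * P.coeff n := by
    rw [hP, coeff_mul_add_eq_of_natDegree_le (natDegree_lin a).le hPd, coeff_lin]
  rw [coeff_iterate_derivative, show a + n + n = a + 2*n by ring, hW,
    coeff_mul_add_eq_of_natDegree_le (natDegree_lin a).le (natDegree_quad n).le, coeff_lin, coeff_quad] at h1
  have h2 : ((a + 2*n).descFactorial n : ℝ) = P.coeff n := by
    have h3 : ((-1:ℝ)^a) ≠ 0 := by simp
    apply mul_left_cancel₀ h3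
    rw [← h1]; simp [mul_comm]
  rw [← h2, eq_div_iff (by positivity)]
  have := Nat.factorial_mul_descFactorial (show n ≤ a + 2*n by omega)
  rw [show a + 2*n - n = a + n by omega] at this
  rw [mul_comm]; exact_mod_cast this

lemma antideriv (P : ℝ[X]) : ∃ S : ℝ[X], derivative S = P ∧ S.eval (-1) = 0 := by
  have : ∃ S : ℝ[X], derivative S = P := by
    induction P using Polynomial.induction_on' with
    | add p q hp hq =>
      obtain ⟨s, rfl⟩ := hp
      obtain ⟨t, rfl⟩ := hq
      exact ⟨s + t, by simp⟩
    | monomial n c =>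
      refine ⟨monomial (n+1) (c/((n:ℝ)+1)), ?_⟩
      rw [derivative_monomial]
      simp only [Nat.add_sub_cancel, Nat.cast_add, Nat.cast_one]
      rw [div_mul_cancel₀ _ (by positivity)]
  obtain ⟨S, rfl⟩ := this
  exact ⟨S - C (S.eval (-1)), by simp, by simp⟩

lemma intJ (n a : ℕ) (S P : ℝ[X]) (hP : derivative^[n] (W n a 0) = (1 - X)^a * P)
    (hS : derivative S = P) (h0 : S.eval (-1) = 0) (x : ℝ) (hx : x < 1) (hx' : -1 < x) :
    intJacobiP (n+1) a x = S.eval x / (2^n * n.factorial) := by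
  unfold intJacobiP
  rw [Nat.add_sub_cancel]
  have : ∫ t in (-1:ℝ)..x, jacobiP n a 0 t =
      ∫ t in (-1:ℝ)..x, (1 / (2^n * n.factorial : ℝ)) * (derivative S).eval t := by
    apply intervalIntegral.integral_congr
    intro t ht
    rw [Set.uIcc_of_le hx'.le] at ht
    have : (1 - t) ≠ 0 := by linarith [ht.2]
    simp only
    rw [jac, hP, hS]
    simp
    field_simp
  rw [this, intervalIntegral.integral_const_mul, ftc, h0]
  ring

lemma divlin (S : ℝ[X]) (n : ℕ) (hd : S.natDegree ≤ n+1) (c : ℝ) (h0 : S.eval c = 0) :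
    ∃ Q : ℝ[X], S = (X - C c) * Q ∧ Q.natDegree ≤ n ∧ Q.coeff n = S.coeff (n+1) := by
  obtain ⟨Q, rfl⟩ := dvd_iff_isRoot.mpr h0
  have hQ : Q.natDegree ≤ n := by
    by_cases hQ0 : Q = 0
    · simp [hQ0]
    rw [natDegree_mul (X_sub_C_ne_zero c) hQ0, natDegree_X_sub_C] at hd
    omega
  refine ⟨Q, rfl, hQ, ?_⟩
  rw [add_comm n 1, coeff_mul_add_eq_of_natDegree_le (natDegree_X_sub_C c).le hQ]
  simp

lemma antideg (S P : ℝ[X]) (n : ℕ) (hS : derivative S = P) (hP : P.natDegree ≤ n) :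
    S.natDegree ≤ n+1 ∧ S.coeff (n+1) = P.coeff n / (n+1) := by
  constructor
  · rw [natDegree_le_iff_coeff_eq_zero]
    intro N hN
    obtain ⟨k, rfl⟩ : ∃ k, N = k+1 := ⟨N-1, by omega⟩
    have h := coeff_derivative S k
    rw [hS, coeff_eq_zero_of_natDegree_lt (by omega)] at h
    have : (k:ℝ)+1 ≠ 0 := by positivity
    simpa [this] using h.symm
  · have h := coeff_derivative S n
    rw [hS] at h
    rw [h]; field_simp

lemma ioo (f g : ℝ → ℝ) (h : ∀ x ∈ Set.Ioo (-1:ℝ) 1, f x = g x) :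
    ∫ x in Set.Ioo (-1:ℝ) 1, f x = ∫ x in (-1:ℝ)..1, g x := by
  rw [intervalIntegral.integral_of_le (by norm_num), integral_Ioc_eq_integral_Ioo]
  exact setIntegral_congr_fun measurableSet_Ioo h

lemma intB (a n : ℕ) : ∫ y in Set.Ioo (-1:ℝ) 1, ((1-y)/2)^a *
      (intJacobiP (n+1) (a+1) y * jacobiP n a 1 y) = 4 / ((2*n+a+2) * (n+a+1)) := by
  obtain ⟨P, hP, hPd, hPc⟩ := jacpoly n (a+1)
  obtain ⟨S, hS, h0⟩ := antideriv P
  obtain ⟨hSd, hSc⟩ := antideg S P n hS hPd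
  obtain ⟨Q, hQ, hQd, hQc⟩ := divlin S n hSd (-1) h0
  rw [ioo _ (fun y => (1/(2^a * (2^n * n.factorial)^2)) *
    (Q * derivative^[n] (W n a 1)).eval y)]
  · rw [intervalIntegral.integral_const_mul, key _ _ _ _ hQd, hQc, hSc, hPc]
    rw [show a + 1 + 2*n = a + 2*n + 1 by ring, show a + 1 + n = a + n + 1 by ring,
      show a + n + (1+n) + 1 = a + 2*n+1+1 by ring, show 1 + n = n + 1 by ring,
      Nat.factorial_succ (a+2*n+1), Nat.factorial_succ (a+n), Nat.factorial_succ n]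
    have h1 : ((a+2*n+1).factorial : ℝ) ≠ 0 := by positivity
    have h2 : ((a+n).factorial : ℝ) ≠ 0 := by positivity
    have h3 : ((n).factorial : ℝ) ≠ 0 := by positivity
    have h4 : (2:ℝ)^(a+2*n+1+1) = 4 * (2^a * (2^n)^2) := by ring
    rw [h4]
    push_cast
    have h5 : (a:ℝ)+n+1 ≠ 0 := by positivity
    have h6 : (a:ℝ)+2*n+1+1 ≠ 0 := by positivity
    have h7 : (n:ℝ)+1 ≠ 0 := by positivity
    have h8 : (2:ℝ)*n+a+2 ≠ 0 := by positivity
    have h9 : (n:ℝ)+a+1 ≠ 0 := by positivity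
    field_simp
    ring
  · intro y hy
    have h1 : 1 - y ≠ 0 := by linarith [hy.2]
    have h2 : 1 + y ≠ 0 := by linarith [hy.1]
    rw [intJ n (a+1) S P hP hS h0 y hy.2 hy.1, jac, hQ]
    simp only [eval_mul, eval_sub, eval_X, eval_C, div_pow]
    field_simp
    ring

lemma intA (m : ℕ) : ∫ y in Set.Ioo (-1:ℝ) 1, 
      (intLegendreP (m+2) y * jacobiP m 1 1 y) = -4 / ((m+2) * (2*m+3)) := by
  obtain ⟨P, hP, hPd, hPc⟩ := jacpoly (m+1) 0
  have hW : W (m+1) 0 0 = (X^2-1)^(m+1) := by simp [W]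
  obtain ⟨S, hSdef⟩ : ∃ S, S = derivative^[m] (W (m+1) 0 0) := ⟨_, rfl⟩
  have hS : derivative S = P := by
    rw [hSdef, ← Function.iterate_succ_apply' derivative, hP]; simp
  have hv := vanish (m+1) m (by omega) (W (m+1) 0 0) (by rw [hW])
  rw [← hSdef] at hv
  obtain ⟨hv1, h0⟩ := hv
  obtain ⟨hSd, hSc⟩ := antideg S P (m+1) hS hPd
  obtain ⟨R, hR, hRd, hRc⟩ := divlin S (m+1) hSd (-1) h0
  have hR1 : R.eval 1 = 0 := by
    rw [hR] at hv1
    rw [eval_mul] at hv1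
    refine (mul_eq_zero.mp hv1).resolve_left ?_
    simp only [eval_sub, eval_X, eval_C]; norm_num
  obtain ⟨Q, hQ, hQd, hQc⟩ := divlin R m hRd 1 hR1
  rw [ioo _ (fun y => (-1/(2^(m+1) * (m+1).factorial * (2^m * m.factorial))) *
    (Q * derivative^[m] (W m 1 1)).eval y)]
  · rw [intervalIntegral.integral_const_mul, key _ _ _ _ hQd, hQc, hRc, hSc, hPc]
    rw [show 0 + 2*(m+1) = 2*m+2 by ring, 
      show 1 + m + (1+m) + 1 = 2*m+2+1 by ring, show 1 + m = m + 1 by ring, zero_add,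
      Nat.factorial_succ (2*m+2), Nat.factorial_succ m]
    have h1 : ((2*m+2).factorial : ℝ) ≠ 0 := by positivity
    have h3 : ((m).factorial : ℝ) ≠ 0 := by positivity
    have h4 : (2:ℝ)^(2*m+2+1) = 4 * (2^(m+1) * (2^m)) := by ring
    rw [h4]
    push_cast
    have h6 : (2*m:ℝ)+2+1 ≠ 0 := by positivity
    have h7 : (m:ℝ)+1 ≠ 0 := by positivity
    have h8 : (m:ℝ)+1+1 ≠ 0 := by positivity
    have h9 : (m:ℝ)+2 ≠ 0 := by positivity
    have h10 : (2*m:ℝ)+3 ≠ 0 := by positivity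
    field_simp
    ring
  · intro y hy
    have h1 : 1 - y ≠ 0 := by linarith [hy.2]
    have h2 : 1 + y ≠ 0 := by linarith [hy.1]
    rw [intLegendreP, intJ (m+1) 0 S P hP hS h0 y hy.2 hy.1, jac, hR, hQ]
    simp only [eval_mul, eval_sub, eval_X, eval_C]
    field_simp
    ring

noncomputable def phi (p : ℝ × ℝ) : ℝ × ℝ := (p.1 * ((1 - p.2)/2), p.2)

noncomputable def dphi (p : ℝ × ℝ) : ℝ × ℝ →L[ℝ] ℝ × ℝ :=
  (Matrix.toLin (.finTwoProd ℝ) (.finTwoProd ℝ)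
    !![(1 - p.2)/2, -p.1/2; 0, 1]).toContinuousLinearMap

lemma det_dphi (p : ℝ × ℝ) : (dphi p).det = (1 - p.2)/2 := by
  unfold dphi
  rw [LinearMap.det_toContinuousLinearMap, LinearMap.det_toLin, Matrix.det_fin_two_of]
  ring

lemma has_dphi (p : ℝ × ℝ) : HasFDerivAt phi (dphi p) p := by
  unfold dphi
  rw [Matrix.toLin_finTwoProd_toContinuousLinearMap]
  have h1 : HasFDerivAt (fun p : ℝ × ℝ => (1 - p.2)/2) ((-1/2 : ℝ) • ContinuousLinearMap.snd ℝ ℝ ℝ) p := by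
    have := ((hasDerivAt_id p.2).const_sub 1).div_const 2
    exact this.comp_hasFDerivAt p hasFDerivAt_snd
  have h2 := HasFDerivAt.prodMk (𝕜 := ℝ) (hasFDerivAt_fst.mul h1) (hasFDerivAt_snd (p := p))
  refine h2.congr_fderiv ?_
  ext <;> simp <;> ring

lemma phi_image : phi '' (Set.Ioo (-1:ℝ) 1 ×ˢ Set.Ioo (-1:ℝ) 1) = Tri := by
  ext ⟨x, y⟩
  simp only [Set.mem_image, Set.mem_prod, Set.mem_Ioo, Tri, Set.mem_setOf_eq, phi, Prod.exists,
    Prod.mk.injEq]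
  constructor
  · rintro ⟨z, w, ⟨⟨h1, h2⟩, h3, h4⟩, rfl, rfl⟩
    refine ⟨h3, h4, ?_⟩
    rw [abs_mul, abs_of_pos (by linarith : 0 < (1 - w)/2)]
    have : |z| < 1 := abs_lt.mpr ⟨h1, h2⟩
    nlinarith
  · rintro ⟨h1, h2, h3⟩
    rw [abs_lt] at h3
    have h : 0 < (1 - y)/2 := by linarith
    refine ⟨x / ((1-y)/2), y, ⟨⟨?_, ?_⟩, h1, h2⟩, div_mul_cancel₀ _ h.ne', rfl⟩
    · rw [lt_div_iff₀ h]; linarith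
    · rw [div_lt_iff₀ h]; linarith

lemma phi_inj : Set.InjOn phi (Set.Ioo (-1:ℝ) 1 ×ˢ Set.Ioo (-1:ℝ) 1) := by
  rintro ⟨x, y⟩ ⟨_, hy⟩ ⟨x', y'⟩ _ h
  simp only [phi, Prod.mk.injEq] at h
  obtain ⟨h1, rfl⟩ := h
  have : (1 - y)/2 ≠ 0 := by have := hy.2; simp at this; linarith
  simpa using mul_right_cancel₀ this h1

end TriAux

open TriAux in
/-- The diagonal value of the triangle `H¹` biorthogonal system. -/
theorem triangle_H1_diagonal_value (i j : ℕ) (hi : 2 ≤ i) (hj : 1 ≤ j) :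
    ∫ p in Tri, uTri i j p * bTri i j p =
      -16 / ((i:ℝ) * (2*(i:ℝ) - 1) * (2*(j:ℝ) + 2*(i:ℝ) - 1) * ((j:ℝ) + 2*(i:ℝ) - 1)) := by
  obtain ⟨m, rfl⟩ : ∃ m, i = m + 2 := ⟨i - 2, by omega⟩
  obtain ⟨n, rfl⟩ : ∃ n, j = n + 1 := ⟨j - 1, by omega⟩
  have hms : MeasurableSet (Set.Ioo (-1:ℝ) 1 ×ˢ Set.Ioo (-1:ℝ) 1) :=
    measurableSet_Ioo.prod measurableSet_Ioo
  rw [← phi_image, integral_image_eq_integral_abs_det_fderiv_smul volume hms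
    (fun p _ => (has_dphi p).hasFDerivWithinAt) phi_inj]
  have h : ∫ p in Set.Ioo (-1:ℝ) 1 ×ˢ Set.Ioo (-1:ℝ) 1, |(dphi p).det| •
      (uTri (m+2) (n+1) (phi p) * bTri (m+2) (n+1) (phi p)) =
      ∫ p in Set.Ioo (-1:ℝ) 1 ×ˢ Set.Ioo (-1:ℝ) 1,
        (intLegendreP (m+2) p.1 * jacobiP m 1 1 p.1) *
        (((1-p.2)/2)^(2*m+3) * (intJacobiP (n+1) (2*m+3+1) p.2 * jacobiP n (2*m+3) 1 p.2)) := by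
    apply setIntegral_congr_fun hms
    rintro ⟨z, y⟩ ⟨_, hy⟩
    have hy2 : 0 < 1 - y := by have := hy.2; simp at this; linarith
    simp only [det_dphi, smul_eq_mul, uTri, bTri, phi]
    rw [abs_of_pos (by linarith), show 2 * (z * ((1-y)/2)) / (1-y) = z by field_simp,
      show 2 * (m+2) = 2*m+3+1 by ring, Nat.add_sub_cancel, Nat.add_sub_cancel, Nat.add_sub_cancel]
    ring
  rw [h, Measure.volume_eq_prod, setIntegral_prod_mul
    (fun z => intLegendreP (m+2) z * jacobiP m 1 1 z)
    (fun y => ((1-y)/2)^(2*m+3) * (intJacobiP (n+1) (2*m+3+1) y * jacobiP n (2*m+3) 1 y)),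
    intA, intB, div_mul_div_comm]
  push_cast
  congr 1
  · norm_num
  · ring
end

section
/- Let i, k ≥ 2 be integers. Then ∫_{−1}^{1} L̂_i(x) P^{(1,1)}_{k−2}(x) dx equals −4/( i (2i−1) ) if i = k, and equals 0 if i ≠ k. (This is the one-dimensional biorthogonality underlying the dual basis on the quadrilateral.) -/
open MeasureTheory

namespace BiAux
open Polynomial

noncomputable def u (n : ℕ) : ℝ[X] := (X ^ 2 - 1) ^ n

noncomputable def D (r : ℕ) (p : ℝ[X]) : ℝ[X] := derivative^[r] p

lemma D_zero (p : ℝ[X]) : D 0 p = p := rfl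

lemma D_succ (r : ℕ) (p : ℝ[X]) : D (r + 1) p = derivative (D r p) :=
  Function.iterate_succ_apply' _ _ _

lemma iter_deriv (p : ℝ[X]) (r : ℕ) :
    iteratedDeriv r (fun x : ℝ => p.eval x) = fun x => (D r p).eval x := by
  induction r with
  | zero => simp [D_zero]
  | succ r ih =>
    rw [iteratedDeriv_succ, ih]
    funext x
    rw [D_succ, Polynomial.deriv]

lemma D_eval_zero (n r : ℕ) (h : r < n) (x : ℝ) (hx : x ^ 2 = 1) :
    (D r (u n)).eval x = 0 := by
  have h1 : (X ^ 2 - 1 : ℝ[X]) ∣ D r (u n) :=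
    (dvd_pow_self _ (by omega)).trans (pow_sub_dvd_iterate_derivative_pow (X ^ 2 - 1 : ℝ[X]) n r)
  obtain ⟨q, hq⟩ := h1
  rw [hq]; simp [hx]

lemma ii (p : ℝ[X]) (a b : ℝ) : IntervalIntegrable (fun x => p.eval x) volume a b :=
  p.continuous.intervalIntegrable _ _

lemma parts (p q : ℝ[X]) (h1 : p.eval 1 = 0) (h2 : p.eval (-1) = 0) :
    ∫ x in (-1:ℝ)..1, (derivative p).eval x * q.eval x
      = - ∫ x in (-1:ℝ)..1, p.eval x * (derivative q).eval x := by
  have h := intervalIntegral.integral_deriv_mul_eq_sub (a := -1) (b := 1)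
    (u := fun x => p.eval x) (v := fun x => q.eval x)
    (fun x _ => p.hasDerivAt x) (fun x _ => q.hasDerivAt x) (ii _ _ _) (ii _ _ _)
  rw [intervalIntegral.integral_add] at h
  · simp only [h1, h2] at h
    linarith
  · simpa using ii (derivative p * q) (-1) 1
  · simpa using ii (p * derivative q) (-1) 1

lemma parts_iter (n r : ℕ) (hr : r ≤ n) (q : ℝ[X]) :
    ∫ x in (-1:ℝ)..1, (D n (u n)).eval x * q.eval x
      = (-1) ^ r * ∫ x in (-1:ℝ)..1, (D (n - r) (u n)).eval x * (D r q).eval x := by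
  induction r with
  | zero => simp [D_zero]
  | succ r ih =>
    rw [ih (by omega), show n - r = (n - (r + 1)) + 1 by omega, D_succ, parts, ← D_succ r]
    · ring
    · exact D_eval_zero _ _ (by omega) _ (by norm_num)
    · exact D_eval_zero _ _ (by omega) _ (by norm_num)

lemma D_add (r s : ℕ) (p : ℝ[X]) : D r (D s p) = D (r + s) p :=
  (Function.iterate_add_apply _ _ _ _).symm

lemma sq_sub : (X ^ 2 - 1 : ℝ[X]) = X ^ 2 - C 1 := by simp

lemma monic_sq : (X ^ 2 - 1 : ℝ[X]).Monic := by
  rw [sq_sub]; exact monic_X_pow_sub_C 1 (by norm_num)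

lemma natDegree_u (n : ℕ) : (u n).natDegree = 2 * n := by
  rw [u, monic_sq.natDegree_pow, sq_sub, natDegree_X_pow_sub_C]; ring

lemma D_top (n : ℕ) : D (2 * n) (u n) = C ((2 * n).factorial : ℝ) := by
  have h0 : (D (2 * n) (u n)).natDegree = 0 := by
    have := natDegree_iterate_derivative (u n) (2 * n)
    rw [natDegree_u] at this
    unfold D; omega
  rw [eq_C_of_natDegree_eq_zero h0]
  congr 1
  have hm : (u n).coeff (2 * n) = 1 := by
    have := (monic_sq.pow n).coeff_natDegree
    rwa [show ((X ^ 2 - 1 : ℝ[X]) ^ n).natDegree = 2 * n from natDegree_u n] at this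
  rw [D, coeff_iterate_derivative, zero_add, hm, Nat.descFactorial_self]
  simp

lemma orth_lt (j n : ℕ) (h : j < n) :
    ∫ x in (-1:ℝ)..1, (D n (u n)).eval x * (D j (u j)).eval x = 0 := by
  rw [parts_iter n n le_rfl, D_add]
  have : D (n + j) (u j) = 0 := by
    apply iterate_derivative_eq_zero
    rw [natDegree_u]; omega
  simp [this]

lemma int_u (n : ℕ) : ((2 * n).factorial : ℝ) * ((-1) ^ n * ∫ x in (-1:ℝ)..1, (u n).eval x)
    = 2 * (2 ^ n * (n.factorial : ℝ)) ^ 2 / (2 * n + 1) := by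
  induction n with
  | zero => simp [u]; norm_num
  | succ n ih =>
    have key : (2 * (n : ℝ) + 3) * (∫ x in (-1:ℝ)..1, (u (n + 1)).eval x)
        = -(2 * n + 2) * ∫ x in (-1:ℝ)..1, (u n).eval x := by
      have h := intervalIntegral.integral_eq_sub_of_hasDerivAt (a := -1) (b := 1)
        (fun x _ => (X * u (n + 1)).hasDerivAt x) (ii _ _ _)
      have e : derivative (X * u (n + 1)) = C (2 * (n : ℝ) + 3) * u (n + 1)
          + C (2 * (n : ℝ) + 2) * u n := by
        simp only [u, derivative_mul, derivative_X, derivative_pow_succ, derivative_sub,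
          derivative_X_pow, derivative_one]
        simp only [C_add, C_mul, map_natCast, map_ofNat, map_one]
        push_cast
        ring
      rw [e] at h
      simp only [eval_add, eval_mul, eval_C] at h
      rw [intervalIntegral.integral_add ((ii _ _ _).const_mul _) ((ii _ _ _).const_mul _),
        intervalIntegral.integral_const_mul, intervalIntegral.integral_const_mul] at h
      simp [u] at h
      simp [u]
      linarith
    have k2 : (∫ x in (-1:ℝ)..1, (u (n + 1)).eval x)
        = -(2 * n + 2) * (∫ x in (-1:ℝ)..1, (u n).eval x) / (2 * (n : ℝ) + 3) := by
      rw [← key]; field_simp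
    rw [k2, show 2 * (n + 1) = (2 * n + 1) + 1 by ring, Nat.factorial_succ, Nat.factorial_succ,
      Nat.factorial_succ]
    push_cast
    have : ((2 * n + 1 + 1 : ℝ) * ((2 * n + 1) * ((2 * n).factorial : ℝ))) * ((-1) ^ (n + 1) *
        (-(2 * n + 2) * (∫ x in (-1:ℝ)..1, (u n).eval x) / (2 * (n : ℝ) + 3)))
        = (((2 * n).factorial : ℝ) * ((-1) ^ n * ∫ x in (-1:ℝ)..1, (u n).eval x)) *
          ((2 * n + 2) ^ 2 * (2 * n + 1) / (2 * n + 3)) := by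
      field_simp; ring
    rw [this, ih]
    field_simp
    ring

lemma norm_sq (n : ℕ) :
    ∫ x in (-1:ℝ)..1, (D n (u n)).eval x * (D n (u n)).eval x
      = 2 * (2 ^ n * (n.factorial : ℝ)) ^ 2 / (2 * n + 1) := by
  rw [parts_iter n n le_rfl, D_add, ← two_mul, D_top, ← int_u]
  simp only [eval_C, intervalIntegral.integral_mul_const, Nat.sub_self, D_zero]
  ring

lemma ode (n r : ℕ) : (X ^ 2 - 1) * D (r + 2) (u n)
    = (2 * (n : ℝ[X]) - 2 * ((r : ℝ[X]) + 1)) * X * D (r + 1) (u n)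
      + ((r : ℝ[X]) + 1) * (2 * (n : ℝ[X]) - (r : ℝ[X])) * D r (u n) := by
  have b0 : (X ^ 2 - 1) * derivative (u n) = 2 * (n : ℝ[X]) * X * u n := by
    cases n with
    | zero => simp [u]
    | succ n =>
      simp only [u, derivative_pow_succ, derivative_sub, derivative_X_pow, derivative_one]
      simp only [C_add, map_natCast, map_one]
      push_cast
      simp
      ring
  induction r with
  | zero =>
    have := congrArg derivative b0
    simp only [derivative_mul, derivative_sub, derivative_X_pow, derivative_one, derivative_X,
      derivative_natCast, derivative_ofNat] at this
    simp only [D_succ, D_zero]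
    push_cast at this ⊢
    simp at this ⊢
    have c2 : (C 2 : ℝ[X]) = 2 := rfl
    rw [c2] at this
    linear_combination this
  | succ r ih =>
    have := congrArg derivative ih
    simp only [derivative_mul, derivative_sub, derivative_X_pow, derivative_one, derivative_X,
      derivative_natCast, derivative_ofNat, derivative_add, ← D_succ] at this
    push_cast at this ⊢
    simp at this
    have c2 : (C 2 : ℝ[X]) = 2 := rfl
    rw [c2] at this
    linear_combination this

lemma ode' (n : ℕ) : (X ^ 2 - 1) * D (n + 2) (u (n + 1))
    = ((n : ℝ[X]) + 1) * ((n : ℝ[X]) + 2) * D n (u (n + 1)) := by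
  rw [ode]; push_cast; ring

lemma intLeg (j : ℕ) (x : ℝ) : intLegendreP (j + 2) x
    = 1 / (2 ^ (j + 1) * ((j + 1).factorial : ℝ)) * (D j (u (j + 1))).eval x := by
  have e : ∀ t : ℝ, jacobiP (j + 1) 0 0 t
      = 1 / (2 ^ (j + 1) * ((j + 1).factorial : ℝ)) * (derivative (D j (u (j + 1)))).eval t := by
    intro t
    rw [jacobiP, ← D_succ]
    have : (fun t : ℝ => (1 - t) ^ 0 * (1 + t) ^ 0 * (t ^ 2 - 1) ^ (j + 1))
        = fun t => (u (j + 1)).eval t := by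
      funext t; simp [u]
    rw [this, iter_deriv]; simp
  rw [intLegendreP, intJacobiP, show j + 2 - 1 = j + 1 by omega]
  simp only [e]
  rw [intervalIntegral.integral_const_mul,
    intervalIntegral.integral_eq_sub_of_hasDerivAt (fun x _ => (D j (u (j + 1))).hasDerivAt x)
      (ii _ _ _), D_eval_zero _ _ (by omega) (-1) (by norm_num), sub_zero]

lemma jac11 (m : ℕ) (x : ℝ) (hx : x ∈ Set.Ioo (-1 : ℝ) 1) : jacobiP m 1 1 x
    = 1 / (2 ^ m * (m.factorial : ℝ) * ((m + 1) * (m + 2))) * (D (m + 2) (u (m + 1))).eval x := by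
  have e : (fun t : ℝ => (1 - t) ^ 1 * (1 + t) ^ 1 * (t ^ 2 - 1) ^ m)
        = fun t => (-u (m + 1)).eval t := by
    funext t; simp [u]; ring
  have o := congrArg (eval x) (ode' m)
  simp at o
  rw [jacobiP, e, iter_deriv]
  have hD : D m (-u (m + 1)) = - D m (u (m + 1)) := iterate_derivative_neg
  have h1 : 1 - x ≠ 0 := by
    have : (0:ℝ) < 1 - x := by linarith [hx.2]
    exact this.ne'
  have h2 : 1 + x ≠ 0 := by
    have : (0:ℝ) < 1 + x := by linarith [hx.1]
    exact this.ne'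
  simp only [hD, eval_neg]
  field_simp
  linear_combination o

lemma main (j m : ℕ) :
    ∫ x in (-1:ℝ)..1, intLegendreP (j + 2) x * jacobiP m 1 1 x
    = - (1 / (2 ^ (j + 1) * ((j + 1).factorial : ℝ)) *
        (1 / (2 ^ m * (m.factorial : ℝ) * ((m + 1) * (m + 2)))) *
      ∫ x in (-1:ℝ)..1, (D (j + 1) (u (j + 1))).eval x * (D (m + 1) (u (m + 1))).eval x) := by
  have p := parts (D j (u (j + 1))) (D (m + 1) (u (m + 1)))
    (D_eval_zero _ _ (by omega) _ (by norm_num)) (D_eval_zero _ _ (by omega) _ (by norm_num))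
  rw [← D_succ, ← D_succ] at p
  rw [p, mul_neg, neg_neg, ← intervalIntegral.integral_const_mul]
  apply intervalIntegral.integral_congr_Ioo_of_le (by norm_num)
  intro x hx
  simp only [intLeg, jac11 m x hx]
  ring

end BiAux

/-- One-dimensional biorthogonality of integrated Legendre polynomials and
Jacobi polynomials `P^{(1,1)}`. -/
theorem intLegendre_jacobi_biorthogonal (i k : ℕ) (hi : 2 ≤ i) (hk : 2 ≤ k) :
    (i = k → ∫ x in (-1:ℝ)..1, intLegendreP i x * jacobiP (k-2) 1 1 x =
      -4 / ((i:ℝ) * (2*(i:ℝ) - 1))) ∧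
    (i ≠ k → ∫ x in (-1:ℝ)..1, intLegendreP i x * jacobiP (k-2) 1 1 x = 0) := by
  obtain ⟨j, rfl⟩ : ∃ j, i = j + 2 := ⟨i - 2, by omega⟩
  obtain ⟨m, rfl⟩ : ∃ m, k = m + 2 := ⟨k - 2, by omega⟩
  rw [Nat.add_sub_cancel, BiAux.main]
  constructor
  · intro h
    obtain rfl : j = m := by omega
    rw [BiAux.norm_sq, Nat.factorial_succ]
    have h1 : (2 * ((j : ℝ) + 2) - 1) ≠ 0 := by
      have : (0:ℝ) ≤ j := j.cast_nonneg
      linarith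
    have h2 : (2 * ((j : ℝ) + 1) + 1) ≠ 0 := by positivity
    have h3 : (j.factorial : ℝ) ≠ 0 := by positivity
    push_cast
    field_simp
    ring
  · intro h
    rcases lt_or_gt_of_ne h with h | h
    · have := BiAux.orth_lt (j + 1) (m + 1) (by omega)
      simp only [mul_comm] at this ⊢
      simp [this]
    · rw [BiAux.orth_lt (m + 1) (j + 1) (by omega)]
      simp
end
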